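/- Let E be a finite-dimensional real vector space, let φ₁, …, φ_m be linear functionals on E, and set E₊ := { x ∈ E : φᵢ(x) ≥ 0 for all i = 1, …, m }. Assume that E₊ spans E (i.e., E₊ − E₊ = E) and that every linear functional on E that is nonnegative on E₊ is a nonnegative linear combination of φ₁, …, φ_m. Let ι : E → ℝ^m be the linear map ι(x) = (φ₁(x), …, φ_m(x)), and equip ℝ^m with the standard cone ℝ^m₊ of coordinatewise-nonnegative vectors. Then for a linear map T : E → E with T(E₊) ⊆ E₊, the following are equivalent: (1) there exists a linear map S : ℝ^m → E with S(ℝ^m₊) ⊆ E₊ and T = S ∘ ι; (2) there exist a natural number k, vectors x₁, …, x_k ∈ E₊, and linear functionals ψ₁, …, ψ_k on E, each nonnegative on E₊, such that T(x) = Σᵢ ψᵢ(x) · xᵢ for all x ∈ E. -/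

import Mathlib

/-- For a finite-dimensional space `E` whose generating polyhedral cone
`E₊ = {x | ∀ i, 0 ≤ φ i x}` has dual wedge generated by `φ 1, …, φ m`, a positive
operator `T : E → E` extends to a positive operator `ℝ^m → E` along
`ι = (φ 1, …, φ m)` iff `T = Σ xᵢ ⊗ ψᵢ` with `xᵢ ∈ E₊` and `ψᵢ` positive. -/
theorem extendable_iff_positive_tensor_form
    (E : Type*) [AddCommGroup E] [Module ℝ E] [FiniteDimensional ℝ E]
    (m : ℕ) (φ : Fin m → Module.Dual ℝ E)
    (Ep : Set E)
    (hEp : Ep = {x : E | ∀ i, 0 ≤ φ i x})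
    (hgen : ∀ x : E, ∃ a ∈ Ep, ∃ b ∈ Ep, x = a - b)
    (hdual : ∀ ψ : Module.Dual ℝ E, (∀ x ∈ Ep, 0 ≤ ψ x) →
      ∃ c : Fin m → ℝ, (∀ i, 0 ≤ c i) ∧ ψ = ∑ i, c i • φ i)
    (T : E →ₗ[ℝ] E) (hT : ∀ x ∈ Ep, T x ∈ Ep) :
    (∃ S : (Fin m → ℝ) →ₗ[ℝ] E,
        (∀ v : Fin m → ℝ, (∀ i, 0 ≤ v i) → S v ∈ Ep) ∧
        ∀ x : E, S (fun i => φ i x) = T x) ↔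
    (∃ (k : ℕ) (x : Fin k → E) (ψ : Fin k → Module.Dual ℝ E),
        (∀ i, x i ∈ Ep) ∧ (∀ i, ∀ y ∈ Ep, 0 ≤ ψ i y) ∧
        ∀ y : E, T y = ∑ i, ψ i y • x i) := by
  subst hEp
  constructor
  · rintro ⟨S, hS, hST⟩
    refine ⟨m, fun i => S (Pi.single i 1), φ, fun i => hS _ fun j => ?_,
      fun i y hy => hy i, fun y => ?_⟩
    · exact (Pi.single_nonneg.2 zero_le_one : (0 : Fin m → ℝ) ≤ Pi.single i 1) j
    · rw [← hST]
      rw [S.pi_apply_eq_sum_univ]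
      refine Finset.sum_congr rfl fun i _ => ?_
      congr 2
      ext j
      simp [Pi.single_apply, eq_comm]
  · rintro ⟨k, x, ψ, hx, hψ, hT_eq⟩
    choose c hc hψc using fun i => hdual (ψ i) (hψ i)
    have hS_apply (v : Fin m → ℝ) :
        (∑ i, (∑ j, c i j • LinearMap.proj (R := ℝ) (φ := fun _ : Fin m => ℝ) j).smulRight
          (x i)) v = ∑ i, (∑ j, c i j * v j) • x i := by
      simp
    refine ⟨_, fun v hv l => ?_, fun y => (hS_apply _).trans ?_⟩
    · rw [hS_apply, map_sum]
      refine Finset.sum_nonneg fun i _ => ?_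
      rw [map_smul, smul_eq_mul]
      exact mul_nonneg (Finset.sum_nonneg fun j _ => mul_nonneg (hc i j) (hv j)) (hx i l)
    · rw [hT_eq]
      refine Finset.sum_congr rfl fun i _ => ?_
      rw [hψc i]
      simp
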